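/- Let n ≥ 2 and h ≤ σ. There exists a constant C > 0 depending only on a, n, D and T such that for every t ∈ [0,T] and every v_σ ∈ V_σ^n(Ω): Σ_{i=1}^N w_i ‖v_σ‖_{L^∞(X_{0→t}(Q_i^h))} ≤ C ‖v_σ‖_{L^1(Ω)}, where X_{0→t}(Q_i^h) denotes the image of the cell Q_i^h under the flow map. -/

import Mathlib

open MeasureTheory
open scoped ENNReal NNReal

noncomputable section

/-- The open unit cube `Ω = (0,1)^D`. -/
def unitCube (D : ℕ) : Set (Fin D → ℝ) := {x | ∀ i, x i ∈ Set.Ioo (0 : ℝ) 1}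

/-- The grid cell with multi-index `k` in the uniform partition of the unit cube into
`M^D` cubes of edge length `1/M`. -/
def cell (D M : ℕ) (k : Fin D → Fin M) : Set (Fin D → ℝ) :=
  {x | ∀ i, ((k i : ℕ) : ℝ) / M ≤ x i ∧ x i < (((k i : ℕ) : ℝ) + 1) / M}

/-- Membership in the tensor-product spline space `V_σ^n(Ω)`, `σ = 1/M`: the function is
`C^{n-2}` on `Ω` and coincides on every grid cell with a polynomial of coordinate-wise
degree at most `n-1`. -/
def IsSpline (D M n : ℕ) (u : (Fin D → ℝ) → ℝ) : Prop :=
  ContDiffOn ℝ (n - 2 : ℕ) u (unitCube D) ∧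
  ∀ k : Fin D → Fin M, ∃ p : MvPolynomial (Fin D) ℝ,
    (∀ i, p.degreeOf i ≤ n - 1) ∧ ∀ x ∈ cell D M k, u x = MvPolynomial.eval x p

/-- A smooth, bounded, divergence-free velocity field `a` on `Ω × [0,T]`, tangent to the
boundary of the unit cube, together with its flow maps: `X τ t = X_{τ→t}`, so that
`X τ t x` is the position at time `t` of the trajectory passing through `x` at time `τ`. -/
structure FlowData (D : ℕ) (T : ℝ) where
  a : (Fin D → ℝ) → ℝ → (Fin D → ℝ)
  X : ℝ → ℝ → (Fin D → ℝ) → (Fin D → ℝ)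
  smooth : ContDiff ℝ (⊤ : ℕ∞) (Function.uncurry a)
  bounded : ∃ B, ∀ x t, ‖a x t‖ ≤ B
  div_free : ∀ x t, ∑ i, fderiv ℝ (fun y => a y t i) x (Pi.single i 1) = 0
  tangent : ∀ t ∈ Set.Icc (0 : ℝ) T, ∀ x ∈ closure (unitCube D), ∀ i,
      (x i = 0 ∨ x i = 1) → a x t i = 0
  flow_init : ∀ τ x, X τ τ x = x
  flow_ode : ∀ τ x t, HasDerivAt (fun s => X τ s x) (a (X τ t x) t) t
  flow_inv : ∀ τ t x, X t τ (X τ t x) = x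

def wcl (s : ℝ) : ℝ := s - max 0 (min s 1)

lemma wcl_bound (s s0 : ℝ) : |wcl s ^ 2 - wcl s0 ^ 2 - 2 * wcl s0 * (s - s0)| ≤ (s - s0) ^ 2 := by
  unfold wcl
  rw [abs_le]
  rcases max_cases 0 (min s 1) with h | h <;> rcases min_cases s 1 with g | g <;>
  rcases max_cases 0 (min s0 1) with h' | h' <;> rcases min_cases s0 1 with g' | g' <;>
  rw [h.1, h'.1] <;> simp only [g.1, g'.1] at * <;> constructor <;> nlinarith

lemma hasDerivAt_wcl (s : ℝ) : HasDerivAt (fun s => wcl s ^ 2) (2 * wcl s) s := by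
  rw [hasDerivAt_iff_isLittleO]
  have h1 : (fun x' => wcl x' ^ 2 - wcl s ^ 2 - (x' - s) • (2 * wcl s)) =O[nhds s]
      (fun x' => (x' - s) ^ 2) := by
    refine Asymptotics.IsBigO.of_bound 1 (Filter.Eventually.of_forall fun x => ?_)
    have := wcl_bound x s
    rw [Real.norm_eq_abs, Real.norm_eq_abs, abs_of_nonneg (sq_nonneg (x - s)), one_mul, smul_eq_mul]
    convert this using 2
    ring
  refine h1.trans_isLittleO ?_
  have h2 : (fun x' => (x' - s) ^ 2) =o[nhds s] (fun x' => (x' - s) ^ 1) :=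
    (Asymptotics.isLittleO_pow_pow (by norm_num : 1 < 2)).comp_tendsto
      (by
        have : Filter.Tendsto (fun x : ℝ => x - s) (nhds s) (nhds (s - s)) :=
          (continuous_id.sub continuous_const).tendsto s
        simpa using this)
  simpa using h2

lemma wcl_zero_iff {s : ℝ} (h : wcl s = 0) : 0 ≤ s ∧ s ≤ 1 := by
  unfold wcl at h
  rcases max_cases 0 (min s 1) with h | h <;> rcases min_cases s 1 with g | g <;> constructor <;> linarith

lemma wcl_zero {s : ℝ} (h0 : 0 ≤ s) (h1 : s ≤ 1) : wcl s = 0 := by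
  simp [wcl, h0, h1]

/-- closed cube -/
def ccube (D : ℕ) : Set (Fin D → ℝ) := {x | ∀ i, 0 ≤ x i ∧ x i ≤ 1}

lemma ccube_subset (D : ℕ) : ccube D ⊆ closure (unitCube D) := by
  intro x hx
  have : unitCube D = Set.pi Set.univ (fun _ => Set.Ioo (0:ℝ) 1) := by
    ext y; simp [unitCube]
  rw [this, closure_pi_set]
  intro i _
  rw [closure_Ioo (by norm_num)]
  exact hx i

lemma ccube_norm {D : ℕ} {x : Fin D → ℝ} (hx : x ∈ ccube D) : ‖x‖ ≤ 1 := by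
  rw [pi_norm_le_iff_of_nonneg (by norm_num)]
  intro i
  rw [Real.norm_eq_abs, abs_le]
  constructor <;> linarith [(hx i).1, (hx i).2]

lemma flow_bound {D : ℕ} {T : ℝ} (hT : 0 < T) (F : FlowData D T) :
    ∃ R : ℝ, 1 ≤ R ∧ ∀ p ∈ ccube D, ∀ s ∈ Set.Icc 0 T, ‖F.X 0 s p‖ ≤ R := by
  obtain ⟨B, hB⟩ := F.bounded
  have hB0 : 0 ≤ B := (norm_nonneg _).trans (hB 0 0)
  refine ⟨1 + B * T, by nlinarith, fun p hp s hs => ?_⟩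
  have := norm_image_sub_le_of_norm_deriv_le_segment' (f := fun s => F.X 0 s p)
    (f' := fun t => F.a (F.X 0 t p) t) (C := B) (a := 0) (b := T)
    (fun x _ => (F.flow_ode 0 p x).hasDerivWithinAt) (fun x _ => hB _ _) s hs
  rw [F.flow_init] at this
  have h2 : ‖F.X 0 s p‖ ≤ ‖F.X 0 s p - p‖ + ‖p‖ := by
    simpa using norm_add_le (F.X 0 s p - p) p
  have := ccube_norm hp
  nlinarith [hs.1, hs.2]

lemma flow_lip {D : ℕ} {T : ℝ} (F : FlowData D T) (R : ℝ) :
    ∃ L : ℝ≥0, ∀ s ∈ Set.Icc 0 T, LipschitzOnWith L (fun x => F.a x s) (Metric.closedBall 0 R) := by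
  obtain ⟨L, hL⟩ := (F.smooth.contDiffOn (s := Metric.closedBall 0 R ×ˢ Set.Icc 0 T)).exists_lipschitzOnWith
    (by simp) ((convex_closedBall _ _).prod (convex_Icc _ _))
    ((isCompact_closedBall _ _).prod isCompact_Icc)
  refine ⟨L, fun s hs => LipschitzOnWith.of_dist_le_mul fun x hx y hy => ?_⟩
  have := hL.dist_le_mul (x, s) ⟨hx, hs⟩ (y, s) ⟨hy, hs⟩
  simpa [Function.uncurry, Prod.dist_eq] using this

lemma flow_inv_cube {D : ℕ} {T : ℝ} (hT : 0 < T) (F : FlowData D T)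
    (p : Fin D → ℝ) (hp : p ∈ ccube D) : ∀ s ∈ Set.Icc 0 T, F.X 0 s p ∈ ccube D := by
  obtain ⟨R, hR1, hR⟩ := flow_bound hT F
  obtain ⟨L, hL⟩ := flow_lip F R
  set x : ℝ → Fin D → ℝ := fun s => F.X 0 s p with hx
  let g : ℝ → ℝ := fun s => ∑ i, wcl (x s i) ^ 2
  let g' : ℝ → ℝ := fun s => ∑ i, 2 * wcl (x s i) * F.a (x s) s i
  have hg : ∀ s, HasDerivAt g (g' s) s := by
    intro s
    refine HasDerivAt.fun_sum fun i _ => ?_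
    have h1 : HasDerivAt (fun s => x s i) (F.a (x s) s i) s :=
      (hasDerivAt_pi.1 (F.flow_ode 0 p s)) i
    exact (hasDerivAt_wcl (x s i)).comp s h1
  have hbd : ∀ s ∈ Set.Ico 0 T, ‖g' s‖ ≤ (2 * L * D) * ‖g s‖ + 0 := by
    intro s hs
    have hs' : s ∈ Set.Icc 0 T := ⟨hs.1, hs.2.le⟩
    let P : Fin D → ℝ := fun i => max 0 (min (x s i) 1)
    have hPc : P ∈ ccube D := fun i => ⟨le_max_left _ _, max_le (by norm_num) (min_le_right _ _)⟩
    have hg0 : 0 ≤ g s := Finset.sum_nonneg fun i _ => sq_nonneg _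
    have hd : ∀ i, |wcl (x s i)| ≤ Real.sqrt (g s) := by
      intro i
      apply Real.abs_le_sqrt
      exact Finset.single_le_sum (f := fun i => wcl (x s i) ^ 2) (fun i _ => sq_nonneg _) (Finset.mem_univ i)
    have hdist : dist (x s) P ≤ Real.sqrt (g s) := by
      rw [dist_pi_le_iff (Real.sqrt_nonneg _)]
      intro i
      exact hd i
    have hlip : dist (F.a (x s) s) (F.a P s) ≤ L * Real.sqrt (g s) := by
      refine ((hL s hs').dist_le_mul _ ?_ _ ?_).trans ?_
      · simpa using hR p hp s hs'
      · simpa using (ccube_norm hPc).trans hR1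
      · gcongr
    have hterm : ∀ i, ‖2 * wcl (x s i) * F.a (x s) s i‖ ≤ 2 * L * g s := by
      intro i
      by_cases hw : wcl (x s i) = 0
      · rw [hw]; simp; positivity
      have hP01 : P i = 0 ∨ P i = 1 := by
        by_contra hcon
        push Not at hcon
        apply hw
        simp only [P] at hcon
        rcases max_cases 0 (min (x s i) 1) with h | h
        · exact absurd h.1 hcon.1
        · rcases min_cases (x s i) 1 with g | g
          · rw [wcl, h.1, g.1, sub_self]
          · exact absurd (h.1.trans g.1) hcon.2
      have hz := F.tangent s hs' P (ccube_subset D hPc) i hP01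
      have h3 : |F.a (x s) s i| ≤ L * Real.sqrt (g s) := by
        have := (dist_le_pi_dist (F.a (x s) s) (F.a P s) i).trans hlip
        rwa [hz, Real.dist_eq, sub_zero] at this
      rw [norm_mul, norm_mul, Real.norm_eq_abs, Real.norm_eq_abs, Real.norm_eq_abs]
      calc |(2:ℝ)| * |wcl (x s i)| * |F.a (x s) s i| ≤ 2 * Real.sqrt (g s) * (L * Real.sqrt (g s)) := by
            rw [abs_of_pos (by norm_num : (0:ℝ) < 2)]
            gcongr
            exact hd i
        _ = 2 * L * (Real.sqrt (g s) * Real.sqrt (g s)) := by ring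
        _ = 2 * L * g s := by rw [Real.mul_self_sqrt hg0]
    calc ‖g' s‖ ≤ ∑ i, ‖2 * wcl (x s i) * F.a (x s) s i‖ := norm_sum_le _ _
      _ ≤ ∑ i : Fin D, 2 * L * g s := Finset.sum_le_sum fun i _ => hterm i
      _ = (2 * L * D) * ‖g s‖ + 0 := by
          rw [Finset.sum_const, Finset.card_univ, Fintype.card_fin, Real.norm_of_nonneg hg0]
          simp; ring
  have key := norm_le_gronwallBound_of_norm_deriv_right_le (f := g) (f' := g') (δ := 0) (a := 0) (b := T)
    (fun s _ => (hg s).continuousAt.continuousWithinAt) (fun s _ => (hg s).hasDerivWithinAt)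
    (by
      have : g 0 = 0 := Finset.sum_eq_zero fun i _ => by
        simp only [hx, F.flow_init]
        rw [wcl_zero (hp i).1 (hp i).2]; simp
      simp [this]) hbd
  intro s hs i
  have h0 := key s hs
  rw [gronwallBound_ε0_δ0] at h0
  have h1 : g s = 0 := norm_le_zero_iff.1 h0
  have h2 := (Finset.sum_eq_zero_iff_of_nonneg (fun i _ => sq_nonneg _)).1 h1 i (Finset.mem_univ i)
  exact wcl_zero_iff (by simpa using h2)

lemma flow_main {D : ℕ} {T : ℝ} (hT : 0 < T) (F : FlowData D T) :
    ∃ L : ℝ, 0 ≤ L ∧ ∀ t ∈ Set.Icc 0 T, ∀ p ∈ ccube D, ∀ q ∈ ccube D,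
      dist p q ≤ L * dist (F.X 0 t p) (F.X 0 t q) := by
  obtain ⟨L, hL⟩ := flow_lip F 1
  refine ⟨Real.exp (L * T), (Real.exp_pos _).le, fun t ht p hp q hq => ?_⟩
  have hder : ∀ p s, HasDerivAt (fun s => F.X 0 (t - s) p) (- F.a (F.X 0 (t - s) p) (t - s)) s := by
    intro p s
    have h1 : HasDerivAt (fun s : ℝ => t - s) (-1) s := by
      simpa using (hasDerivAt_id s).const_sub t
    have := (F.flow_ode 0 p (t - s)).scomp s h1
    rw [neg_one_smul] at this
    exact this
  have hmem : ∀ s ∈ Set.Ico 0 t, t - s ∈ Set.Icc 0 T := fun s hs =>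
    ⟨by linarith [hs.2], by linarith [hs.1, ht.2]⟩
  have := dist_le_of_trajectories_ODE_of_mem (v := fun s x => - F.a x (t - s)) (K := L)
    (s := fun _ => Metric.closedBall 0 1) (a := 0) (b := t) (f := fun s => F.X 0 (t - s) p)
    (g := fun s => F.X 0 (t - s) q) (δ := dist (F.X 0 t p) (F.X 0 t q))
    (fun s hs => (hL (t - s) (hmem s hs)).neg)
    (fun s _ => (hder p s).continuousAt.continuousWithinAt)
    (fun s _ => (hder p s).hasDerivWithinAt)
    (fun s hs => by simpa using ccube_norm (flow_inv_cube hT F p hp _ (hmem s hs)))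
    (fun s _ => (hder q s).continuousAt.continuousWithinAt)
    (fun s _ => (hder q s).hasDerivWithinAt)
    (fun s hs => by simpa using ccube_norm (flow_inv_cube hT F q hq _ (hmem s hs)))
    (by simp) t ⟨ht.1, le_rfl⟩
  simp only [sub_self, F.flow_init, sub_zero] at this
  rw [mul_comm] at this
  refine this.trans ?_
  gcongr
  exact ht.2

/-- tensor polynomial with given coefficients -/
def tpoly {D n : ℕ} (c : (Fin D → Fin n) → ℝ) (y : Fin D → ℝ) : ℝ :=
  ∑ β, c β * ∏ i, y i ^ (β i : ℕ)

lemma tpoly_affine {D n : ℕ} (hn : 1 ≤ n) (p : MvPolynomial (Fin D) ℝ)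
    (hp : ∀ i, p.degreeOf i ≤ n - 1) (b : Fin D → ℝ) (r : ℝ) :
    ∃ c : (Fin D → Fin n) → ℝ, ∀ y, MvPolynomial.eval (fun i => b i + r * y i) p = tpoly c y := by
  let B : (Fin D →₀ ℕ) → Fin D → Fin n → ℝ := fun m i j =>
    ((Polynomial.C (b i) + Polynomial.C r * Polynomial.X) ^ (m i)).coeff j
  refine ⟨fun β => ∑ m ∈ p.support, p.coeff m * ∏ i, B m i (β i), fun y => ?_⟩
  rw [MvPolynomial.eval_eq', tpoly]
  simp_rw [Finset.sum_mul]
  rw [Finset.sum_comm]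
  refine Finset.sum_congr rfl fun m hm => ?_
  have h1 : ∀ i, (b i + r * y i) ^ m i = ∑ j : Fin n, B m i j * y i ^ (j : ℕ) := by
    intro i
    have hd : ((Polynomial.C (b i) + Polynomial.C r * Polynomial.X) ^ (m i)).natDegree < n := by
      have h2 : m i ≤ n - 1 := MvPolynomial.degreeOf_le_iff.1 (hp i) m hm
      have h3 : (Polynomial.C (b i) + Polynomial.C r * Polynomial.X).natDegree ≤ 1 := by
        compute_degree
      have h4 := Polynomial.natDegree_pow_le_of_le (m i) h3
      omega
    have := Polynomial.eval_eq_sum_range' hd (y i)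
    rw [Finset.sum_range] at this
    simpa using this
  simp_rw [h1]
  rw [Finset.prod_univ_sum, Finset.mul_sum]
  simp [Finset.prod_mul_distrib, mul_assoc]

lemma tpoly_continuous {D n : ℕ} (c : (Fin D → Fin n) → ℝ) : Continuous (tpoly c) := by
  unfold tpoly
  fun_prop

lemma unitCube_eq (D : ℕ) : unitCube D = Set.pi Set.univ (fun _ => Set.Ioo (0:ℝ) 1) := by
  ext y; simp [unitCube]

lemma unitCube_open (D : ℕ) : IsOpen (unitCube D) := by
  rw [unitCube_eq]
  exact isOpen_set_pi Set.finite_univ fun _ _ => isOpen_Ioo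

lemma tpoly_le {D n : ℕ} (c : (Fin D → Fin n) → ℝ) (y : Fin D → ℝ)
    (hy : ∀ i, 0 ≤ y i ∧ y i ≤ 1) : ‖tpoly c y‖ ≤ (Fintype.card (Fin D → Fin n)) * ‖c‖ := by
  unfold tpoly
  refine (norm_sum_le _ _).trans ?_
  calc _ ≤ ∑ β : Fin D → Fin n, ‖c‖ := by
        refine Finset.sum_le_sum fun β _ => ?_
        rw [norm_mul]
        have h1 : ‖∏ i, y i ^ (β i : ℕ)‖ ≤ 1 := by
          rw [Real.norm_of_nonneg (Finset.prod_nonneg fun i _ => pow_nonneg (hy i).1 _)]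
          exact Finset.prod_le_one (fun i _ => pow_nonneg (hy i).1 _)
            fun i _ => pow_le_one₀ (hy i).1 (hy i).2
        have h2 := norm_le_pi_norm c β
        nlinarith [norm_nonneg (c β), norm_nonneg (∏ i, y i ^ (β i : ℕ))]
    _ = _ := by simp

lemma tpoly_inj {D n : ℕ} (c : (Fin D → Fin n) → ℝ) (h : ∀ y ∈ unitCube D, tpoly c y = 0) :
    c = 0 := by
  classical
  let e : (Fin D → Fin n) → (Fin D →₀ ℕ) := fun β => Finsupp.equivFunOnFinite.symm fun i => (β i : ℕ)
  have he : Function.Injective e := by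
    intro β γ hh
    have := Finsupp.equivFunOnFinite.symm.injective hh
    funext i
    exact Fin.ext (congrFun this i)
  let P : MvPolynomial (Fin D) ℝ := ∑ β, MvPolynomial.monomial (e β) (c β)
  have hP : P = 0 := by
    refine MvPolynomial.funext_set (fun _ => Set.Ioo (0:ℝ) 1) (fun _ => Set.Ioo_infinite (by norm_num)) ?_
    intro x hx
    have := h x (by rw [unitCube_eq]; exact hx)
    simp only [P, map_sum, MvPolynomial.eval_monomial, map_zero]
    rw [← this, tpoly]
    refine Finset.sum_congr rfl fun β _ => ?_
    rw [Finsupp.prod_fintype _ _ (by simp)]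
    simp [e]
  funext β
  have := congrArg (MvPolynomial.coeff (e β)) hP
  simpa [P, MvPolynomial.coeff_sum, MvPolynomial.coeff_monomial, he.eq_iff] using this

lemma tpoly_memLp {D n : ℕ} (c : (Fin D → Fin n) → ℝ) :
    MemLp (tpoly c) 1 (volume.restrict (unitCube D)) := by
  rw [memLp_one_iff_integrable]
  have hc : IsCompact (Set.pi Set.univ (fun _ : Fin D => Set.Icc (0:ℝ) 1)) :=
    isCompact_univ_pi fun _ => isCompact_Icc
  refine IntegrableOn.mono_set (t := Set.pi Set.univ (fun _ => Set.Icc (0:ℝ) 1))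
    ((tpoly_continuous c).continuousOn.integrableOn_compact hc) ?_
  rw [unitCube_eq]
  exact Set.pi_mono fun _ _ => Set.Ioo_subset_Icc_self

lemma tpoly_inverse (D n : ℕ) : ∃ C : ℝ≥0, ∀ c : (Fin D → Fin n) → ℝ, ∀ y : Fin D → ℝ,
    (∀ i, 0 ≤ y i ∧ y i ≤ 1) →
    ‖tpoly c y‖ₑ ≤ C * ∫⁻ x in unitCube D, ‖tpoly c x‖ₑ := by
  let f : ((Fin D → Fin n) → ℝ) →ₗ[ℝ] Lp ℝ 1 (volume.restrict (unitCube D)) :=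
    { toFun := fun c => (tpoly_memLp c).toLp
      map_add' := fun c d => by
        rw [← MemLp.toLp_add]
        apply MemLp.toLp_congr
        refine Filter.Eventually.of_forall fun x => ?_
        simp [tpoly, add_mul, Finset.sum_add_distrib]
      map_smul' := fun a c => by
        rw [RingHom.id_apply, ← MemLp.toLp_const_smul]
        apply MemLp.toLp_congr
        refine Filter.Eventually.of_forall fun x => ?_
        simp [tpoly, Finset.mul_sum, mul_assoc] }
  have hf : LinearMap.ker f = ⊥ := by
    rw [LinearMap.ker_eq_bot']
    intro c hc
    apply tpoly_inj
    have h1 : tpoly c =ᵐ[volume.restrict (unitCube D)] 0 := by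
      have := (tpoly_memLp c).coeFn_toLp
      have h2 : (tpoly_memLp c).toLp = 0 := hc
      rw [h2] at this
      exact this.symm.trans (Lp.coeFn_zero _ _ _)
    exact Measure.eqOn_open_of_ae_eq h1 (unitCube_open D) (tpoly_continuous c).continuousOn
      continuousOn_const
  obtain ⟨K, hK, hL⟩ := f.exists_antilipschitzWith hf
  refine ⟨(Fintype.card (Fin D → Fin n)) * K, fun c y hy => ?_⟩
  have h1 := hL.le_mul_dist c 0
  rw [map_zero, dist_zero_right, dist_zero_right] at h1
  have h2 : ‖tpoly c y‖ ≤ (Fintype.card (Fin D → Fin n)) * (K * ‖f c‖) :=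
    (tpoly_le c y hy).trans (by gcongr)
  have h3 : ‖f c‖ₑ = ∫⁻ x in unitCube D, ‖tpoly c x‖ₑ := by
    have : ‖f c‖ₑ = eLpNorm (tpoly c) 1 (volume.restrict (unitCube D)) := Lp.enorm_toLp (tpoly_memLp c)
    rw [this, eLpNorm_one_eq_lintegral_enorm]
  rw [← h3, ← ofReal_norm, ← ofReal_norm]
  refine (ENNReal.ofReal_le_ofReal h2).trans ?_
  rw [← mul_assoc, ENNReal.ofReal_mul (by positivity)]
  gcongr
  rw [← ENNReal.ofReal_coe_nnreal]
  simp

/-- open cell -/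
def ocell (D M : ℕ) (k : Fin D → Fin M) : Set (Fin D → ℝ) :=
  {x | ∀ i, ((k i : ℕ) : ℝ) / M < x i ∧ x i < (((k i : ℕ) : ℝ) + 1) / M}

lemma spline_inverse (D n : ℕ) (hn : 1 ≤ n) : ∃ C : ℝ≥0, ∀ M : ℕ, 0 < M → ∀ v, IsSpline D M n v →
    ∀ k : Fin D → Fin M, ∀ x ∈ cell D M k,
    ‖v x‖ₑ ≤ C * (ENNReal.ofReal ((M:ℝ) ^ D) * ∫⁻ z in ocell D M k, ‖v z‖ₑ) := by
  obtain ⟨C, hC⟩ := tpoly_inverse D n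
  refine ⟨C, fun M hM v hv k x hx => ?_⟩
  obtain ⟨p, hp, hpv⟩ := hv.2 k
  have hM' : (0:ℝ) < M := by exact_mod_cast hM
  let b : Fin D → ℝ := fun i => ((k i : ℕ) : ℝ) / M
  let r : ℝ := 1 / M
  have hr : 0 < r := by positivity
  obtain ⟨c, hc⟩ := tpoly_affine hn p hp b r
  have hx' : ∀ z : Fin D → ℝ, z = fun i => b i + r * ((z i - b i) * M) := by
    intro z; funext i; simp only [b, r]; field_simp; ring
  have e1 : v x = tpoly c (fun i => (x i - b i) * M) := by
    rw [hpv x hx, ← hc]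
    congr 2
    exact hx' x
  rw [e1]
  refine (hC c _ fun i => ?_).trans ?_
  · have := hx i
    rw [div_le_iff₀ hM', lt_div_iff₀ hM'] at this
    have hb : b i * M = (k i : ℕ) := by simp only [b]; field_simp
    rw [sub_mul, hb]
    constructor <;> linarith
  gcongr
  have hopen : MeasurableSet (ocell D M k) := by
    have : ocell D M k = Set.pi Set.univ
      (fun i => Set.Ioo (((k i : ℕ) : ℝ) / M) ((((k i : ℕ) : ℝ) + 1) / M)) := by
      ext y; simp [ocell]
    rw [this]
    exact MeasurableSet.univ_pi fun _ => measurableSet_Ioo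
  have hpt : ∀ y : Fin D → ℝ, (unitCube D).indicator (fun y => ‖tpoly c y‖ₑ) y =
      (fun z => (ocell D M k).indicator (fun z => ‖v z‖ₑ) (b + z)) (r • y) := by
    intro y
    have hiff : b + r • y ∈ ocell D M k ↔ y ∈ unitCube D := by
      simp only [ocell, unitCube, Set.mem_ofPred_eq, Set.mem_Ioo]
      refine forall_congr' fun i => ?_
      simp only [b, r, Pi.add_apply, Pi.smul_apply, smul_eq_mul]
      rw [div_lt_iff₀ hM', lt_div_iff₀ hM']
      have : (((k i : ℕ):ℝ) / M + 1 / M * y i) * M = (k i : ℕ) + y i := by field_simp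
      rw [this]
      constructor <;> rintro ⟨h1, h2⟩ <;> constructor <;> linarith
    by_cases hy : y ∈ unitCube D
    · rw [Set.indicator_of_mem hy]
      simp only
      rw [Set.indicator_of_mem (hiff.2 hy)]
      have hz := hiff.2 hy
      rw [hpv _ (fun i => ⟨(hz i).1.le, (hz i).2⟩), ← hc]
      rfl
    · rw [Set.indicator_of_notMem hy]
      simp only
      rw [Set.indicator_of_notMem (fun h => hy (hiff.1 h))]
  rw [← lintegral_indicator (unitCube_open D).measurableSet, ← lintegral_indicator hopen]
  simp_rw [hpt]
  have hsm := Measure.map_addHaar_smul (volume : Measure (Fin D → ℝ)) hr.ne'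
  have hemb : MeasurableEmbedding (fun y : Fin D → ℝ => r • y) :=
    (Homeomorph.smulOfNeZero r hr.ne').measurableEmbedding
  rw [← hemb.lintegral_map (fun z => (ocell D M k).indicator (fun z => ‖v z‖ₑ) (b + z)), hsm,
    lintegral_smul_measure, lintegral_add_left_eq_self]
  simp [r, abs_of_pos hM']

lemma cell_eq (D M : ℕ) (k : Fin D → Fin M) : cell D M k = Set.pi Set.univ
    (fun i => Set.Ico (((k i : ℕ) : ℝ) / M) ((((k i : ℕ) : ℝ) + 1) / M)) := by
  ext y; simp [cell]

lemma cell_meas (D M : ℕ) (k : Fin D → Fin M) : MeasurableSet (cell D M k) := by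
  rw [cell_eq]
  exact MeasurableSet.univ_pi fun _ => measurableSet_Ico

lemma ocell_meas (D M : ℕ) (k : Fin D → Fin M) : MeasurableSet (ocell D M k) := by
  have : ocell D M k = Set.pi Set.univ
      (fun i => Set.Ioo (((k i : ℕ) : ℝ) / M) ((((k i : ℕ) : ℝ) + 1) / M)) := by
    ext y; simp [ocell]
  rw [this]
  exact MeasurableSet.univ_pi fun _ => measurableSet_Ioo

lemma cell_vol (D M : ℕ) (k : Fin D → Fin M) :
    volume (cell D M k) = ENNReal.ofReal (((1 : ℝ) / M) ^ D) := by
  rw [cell_eq, Real.volume_pi_Ico]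
  have : ∀ i, (((k i : ℕ) : ℝ) + 1) / M - ((k i : ℕ) : ℝ) / M = 1 / M := fun i => by ring
  simp_rw [this]
  rw [Finset.prod_const, Finset.card_univ, Fintype.card_fin, ENNReal.ofReal_pow (by positivity)]

lemma cell_disj (D M : ℕ) (hM : 0 < M) : Pairwise (Function.onFun Disjoint (cell D M)) := by
  intro k l hkl
  rw [Function.onFun, Set.disjoint_left]
  intro x hk hl
  apply hkl
  funext i
  have hM' : (0:ℝ) < M := by exact_mod_cast hM
  have h1 := hk i
  have h2 := hl i
  rw [div_le_iff₀ hM', lt_div_iff₀ hM'] at h1 h2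
  have h3 : ((k i : ℕ) : ℝ) < (l i : ℕ) + 1 := by linarith
  have h4 : ((l i : ℕ) : ℝ) < (k i : ℕ) + 1 := by linarith
  have h5 : (k i : ℕ) < (l i : ℕ) + 1 := by exact_mod_cast h3
  have h6 : (l i : ℕ) < (k i : ℕ) + 1 := by exact_mod_cast h4
  exact Fin.ext (by omega)

lemma ocell_sub (D M : ℕ) (k : Fin D → Fin M) : ocell D M k ⊆ cell D M k :=
  fun _ hx i => ⟨(hx i).1.le, (hx i).2⟩

lemma ocell_sub_cube (D M : ℕ) (hM : 0 < M) (k : Fin D → Fin M) : ocell D M k ⊆ unitCube D := by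
  intro x hx i
  have hM' : (0:ℝ) < M := by exact_mod_cast hM
  refine ⟨lt_of_le_of_lt (by positivity) (hx i).1, (hx i).2.trans_le ?_⟩
  rw [div_le_one hM']
  exact_mod_cast (k i).2

lemma cell_sub_ccube (D M : ℕ) (hM : 0 < M) (k : Fin D → Fin M) : cell D M k ⊆ ccube D := by
  intro x hx i
  have hM' : (0:ℝ) < M := by exact_mod_cast hM
  refine ⟨le_trans (by positivity) (hx i).1, (hx i).2.le.trans ?_⟩
  rw [div_le_one hM']
  exact_mod_cast (k i).2

lemma cell_dist (D M : ℕ) (k : Fin D → Fin M) {x y : Fin D → ℝ}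
    (hx : x ∈ cell D M k) (hy : y ∈ cell D M k) : dist x y ≤ 1 / M := by
  rw [dist_pi_le_iff (by positivity)]
  intro i
  have h1 := hx i
  have h2 := hy i
  rw [add_div] at h1 h2
  rw [Real.dist_eq, abs_le]
  constructor <;> linarith

lemma cell_cover (D M : ℕ) (hM : 0 < M) (x : Fin D → ℝ) (hx : x ∈ ccube D) (h1 : ∀ i, x i ≠ 1) :
    ∃ j, x ∈ cell D M j := by
  have hM' : (0:ℝ) < M := by exact_mod_cast hM
  refine ⟨fun i => ⟨⌊x i * M⌋₊, ?_⟩, fun i => ?_⟩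
  · rw [Nat.floor_lt (mul_nonneg (hx i).1 hM'.le)]
    have := lt_of_le_of_ne (hx i).2 (h1 i)
    nlinarith
  · rw [div_le_iff₀ hM', lt_div_iff₀ hM']
    exact ⟨Nat.floor_le (mul_nonneg (hx i).1 hM'.le), Nat.lt_floor_add_one _⟩

lemma cell_count (D K : ℕ) (hK : 0 < K) (S : Finset (Fin D → Fin K)) (r : ℝ) (hr : 0 ≤ r)
    (h : ∀ k ∈ S, ∀ l ∈ S, ∃ x ∈ cell D K k, ∃ y ∈ cell D K l, dist x y ≤ r) :
    ∑ _k ∈ S, ENNReal.ofReal (((1 : ℝ) / K) ^ D) ≤ ENNReal.ofReal ((2 * (r + 2 / K)) ^ D) := by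
  rcases S.eq_empty_or_nonempty with rfl | ⟨l, hl⟩
  · simp
  obtain ⟨y0, hy0, -⟩ := h l hl l hl
  have hsub : (⋃ k ∈ S, cell D K k) ⊆ Metric.closedBall y0 (r + 2 / K) := by
    intro z hz
    simp only [Set.mem_iUnion] at hz
    obtain ⟨k, hk, hz⟩ := hz
    obtain ⟨x, hx, y, hy, hxy⟩ := h k hk l hl
    have a1 := cell_dist D K k hz hx
    have a2 := cell_dist D K l hy hy0
    have a3 := dist_triangle4 z x y y0
    rw [Metric.mem_closedBall]
    have : (2:ℝ) / K = 1 / K + 1 / K := by ring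
    linarith
  calc ∑ k ∈ S, ENNReal.ofReal (((1 : ℝ) / K) ^ D) = ∑ k ∈ S, volume (cell D K k) := by
        simp_rw [cell_vol]
    _ = volume (⋃ k ∈ S, cell D K k) :=
        (measure_biUnion_finset (fun a _ b _ hab => cell_disj D K hK hab)
          fun k _ => cell_meas D K k).symm
    _ ≤ volume (Metric.closedBall y0 (r + 2 / K)) := measure_mono hsub
    _ = _ := by rw [Real.volume_pi_closedBall _ (by positivity), Fintype.card_fin]

theorem sum_local_sup_le_L1
    (D : ℕ) (hD : 0 < D) (T : ℝ) (hT : 0 < T) (F : FlowData D T)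
    (n : ℕ) (hn : 2 ≤ n) :
    ∃ C : ℝ, 0 < C ∧
      ∀ M K : ℕ, 0 < M → M ≤ K →
      ∀ t ∈ Set.Icc (0 : ℝ) T,
      ∀ v : (Fin D → ℝ) → ℝ, IsSpline D M n v →
        ∑ k : Fin D → Fin K,
            ENNReal.ofReal (((1 : ℝ) / K) ^ D) *
              eLpNorm v ⊤ (volume.restrict (F.X 0 t '' cell D K k)) ≤
          ENNReal.ofReal C * eLpNorm v 1 (volume.restrict (unitCube D)) := by
  classical
  obtain ⟨L, hL0, hL⟩ := flow_main hT F
  obtain ⟨C, hC⟩ := spline_inverse D n (by omega)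
  refine ⟨(C + 1) * (2 * (L + 2)) ^ D, by positivity, fun M K hM hMK t ht v hv => ?_⟩
  have hK : 0 < K := hM.trans_le hMK
  have hM' : (0:ℝ) < M := by exact_mod_cast hM
  have hK' : (0:ℝ) < K := by exact_mod_cast hK
  let I : (Fin D → Fin M) → ℝ≥0∞ := fun j => ∫⁻ z in ocell D M j, ‖v z‖ₑ
  let A : (Fin D → Fin M) → ℝ≥0∞ := fun j => C * (ENNReal.ofReal ((M:ℝ) ^ D) * I j)
  let R : (Fin D → Fin K) → (Fin D → Fin M) → Prop := fun k j =>
    (F.X 0 t '' cell D K k ∩ cell D M j).Nonempty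
  have hsup : ∀ k, eLpNorm v ⊤ (volume.restrict (F.X 0 t '' cell D K k)) ≤
      ∑ j, if R k j then A j else 0 := by
    intro k
    let N : Set (Fin D → ℝ) := ⋃ i, {x | x i = 1}
    let S' : Set (Fin D → ℝ) := N ∪ ⋃ j ∈ {j | R k j}, cell D M j
    have hN0 : volume N = 0 := by
      refine measure_iUnion_null fun i => ?_
      exact Measure.pi_hyperplane (fun _ : Fin D => (volume : Measure ℝ)) i 1
    have hNm : MeasurableSet N :=
      MeasurableSet.iUnion fun i => measurableSet_eq_fun (measurable_pi_apply i) measurable_const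
    have hSm : MeasurableSet S' :=
      hNm.union (MeasurableSet.biUnion (Set.to_countable _) fun j _ => cell_meas D M j)
    have hsub : F.X 0 t '' cell D K k ⊆ S' := by
      rintro x ⟨p, hp, rfl⟩
      by_cases h1 : ∃ i, F.X 0 t p i = 1
      · left
        exact Set.mem_iUnion.2 h1
      · right
        push Not at h1
        obtain ⟨j, hj⟩ := cell_cover D M hM _
          (flow_inv_cube hT F p (cell_sub_ccube D K hK k hp) t ht) h1
        exact Set.mem_biUnion (show R k j from ⟨_, ⟨p, hp, rfl⟩, hj⟩) hj
    refine (eLpNorm_mono_measure v (Measure.restrict_mono hsub le_rfl)).trans ?_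
    rw [eLpNorm_exponent_top]
    refine eLpNormEssSup_le_of_ae_enorm_bound ?_
    rw [ae_restrict_iff' hSm]
    have : ∀ᵐ x ∂(volume : Measure (Fin D → ℝ)), x ∉ N := measure_eq_zero_iff_ae_notMem.1 hN0
    filter_upwards [this] with x hx hxS
    rcases hxS with hxS | hxS
    · exact absurd hxS hx
    simp only [Set.mem_iUnion] at hxS
    obtain ⟨j, hj, hxj⟩ := hxS
    have hj' : R k j := hj
    refine (hC M hM v hv j x hxj).trans ?_
    have := Finset.single_le_sum (f := fun j => if R k j then A j else 0)
      (fun _ _ => zero_le) (Finset.mem_univ j)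
    simp only [if_pos hj'] at this
    exact this
  have hcount : ∀ j, ∑ k ∈ Finset.univ.filter (fun k => R k j), ENNReal.ofReal (((1 : ℝ) / K) ^ D) ≤
      ENNReal.ofReal ((2 * (L + 2)) ^ D * (1 / M) ^ D) := by
    intro j
    refine (cell_count D K hK _ (L * (1 / M)) (by positivity) ?_).trans ?_
    · intro k hk l hl
      obtain ⟨_, ⟨p, hp, rfl⟩, hpj⟩ := (Finset.mem_filter.1 hk).2
      obtain ⟨_, ⟨q, hq, rfl⟩, hqj⟩ := (Finset.mem_filter.1 hl).2
      refine ⟨p, hp, q, hq, ?_⟩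
      refine (hL t ht p (cell_sub_ccube D K hK k hp) q (cell_sub_ccube D K hK l hq)).trans ?_
      gcongr
      exact cell_dist D M j hpj hqj
    · apply ENNReal.ofReal_le_ofReal
      rw [← mul_pow]
      refine pow_le_pow_left₀ (by positivity) ?_ D
      have : (2:ℝ) / K ≤ 2 / M := by gcongr
      calc 2 * (L * (1 / M) + 2 / K) ≤ 2 * (L * (1 / M) + 2 / M) := by gcongr
        _ = _ := by ring
  have hI : ∑ j, I j ≤ eLpNorm v 1 (volume.restrict (unitCube D)) := by
    rw [eLpNorm_one_eq_lintegral_enorm]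
    have := lintegral_biUnion_finset (μ := (volume : Measure (Fin D → ℝ))) (s := Finset.univ) (t := ocell D M)
      (fun a _ b _ hab => (cell_disj D M hM hab).mono (ocell_sub D M a) (ocell_sub D M b))
      (fun j _ => ocell_meas D M j) (fun z => ‖v z‖ₑ)
    rw [← this]
    exact lintegral_mono_set (Set.iUnion₂_subset fun j _ => ocell_sub_cube D M hM j)
  calc ∑ k : Fin D → Fin K, ENNReal.ofReal (((1 : ℝ) / K) ^ D) *
              eLpNorm v ⊤ (volume.restrict (F.X 0 t '' cell D K k))
      ≤ ∑ k : Fin D → Fin K, ENNReal.ofReal (((1 : ℝ) / K) ^ D) * ∑ j, if R k j then A j else 0 := by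
        gcongr with k
        exact hsup k
    _ = ∑ j, A j * ∑ k ∈ Finset.univ.filter (fun k => R k j), ENNReal.ofReal (((1 : ℝ) / K) ^ D) := by
        simp_rw [Finset.mul_sum, Finset.sum_filter]
        rw [Finset.sum_comm]
        refine Finset.sum_congr rfl fun j _ => Finset.sum_congr rfl fun k _ => ?_
        split_ifs
        · rw [mul_comm]
        · simp
    _ ≤ ∑ j, A j * ENNReal.ofReal ((2 * (L + 2)) ^ D * (1 / M) ^ D) := by
        gcongr with j
        exact hcount j
    _ = ∑ j, C * ENNReal.ofReal ((2 * (L + 2)) ^ D) * I j := by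
        refine Finset.sum_congr rfl fun j _ => ?_
        have e : ENNReal.ofReal ((M:ℝ) ^ D) * ENNReal.ofReal ((2 * (L + 2)) ^ D * (1 / M) ^ D) =
            ENNReal.ofReal ((2 * (L + 2)) ^ D) := by
          rw [← ENNReal.ofReal_mul (by positivity)]
          congr 1
          rw [mul_left_comm, ← mul_pow (M:ℝ), mul_one_div_cancel hM'.ne', one_pow, mul_one]
        rw [← e]
        simp only [A]
        ring
    _ = C * ENNReal.ofReal ((2 * (L + 2)) ^ D) * ∑ j, I j := by rw [Finset.mul_sum]
    _ ≤ ENNReal.ofReal ((C + 1) * (2 * (L + 2)) ^ D) * eLpNorm v 1 (volume.restrict (unitCube D)) := by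
        gcongr
        rw [ENNReal.ofReal_mul (by positivity)]
        gcongr
        rw [← ENNReal.ofReal_coe_nnreal]
        apply ENNReal.ofReal_le_ofReal
        linarith

end
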